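/- Suppose ℓ ≥ [n(n+1) + m(m+1)]/2 and the pair (Ã + Σ̃_A', B̃ + Σ̃_B') is controllable. For fixed μ₀ ∈ ℝ^n and X̃₀ ∈ ℝ^{n(n+1)/2}, define μ_{t+1} = A μ_t + B ν_t, W_t = vec(μ_t ν_tᵀ), W_t' = vec(ν_t μ_tᵀ), Ũ_t = P₂ vec(Ū_t + ν_t ν_tᵀ), and X̃_{t+1} = (Ã + Σ̃_A') X̃_t + (B̃ + Σ̃_B') Ũ_t + K_{BA} W_t + K_{AB} W_t', and let D = [[X̃_{ℓ−1} ⋯ X̃₀]; [Ũ_{ℓ−1} ⋯ Ũ₀]] ∈ ℝ^{([n(n+1)+m(m+1)]/2)×ℓ}. Then D has full row rank — and consequently D Dᵀ is invertible — for Lebesgue-almost all (ν₀ᵀ, …, ν_{ℓ−1}ᵀ, svec(Ū₀)ᵀ, …, svec(Ū_{ℓ−1})ᵀ)ᵀ ∈ ℝ^{ℓ m(m+3)/2}, where the Ū_t range over symmetric m×m matrices. -/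

import Mathlib

open MeasureTheory ProbabilityTheory Matrix Filter

namespace MultNoise

lemma encLt {n p a b : ℕ} (ha : a < n) (hb : b < p) : a * p + b < n * p := by
  calc a * p + b < a * p + p := by omega
    _ = (a + 1) * p := by ring
    _ ≤ n * p := Nat.mul_le_mul_right p ha

lemma triLt {n i j : ℕ} (hi : i < n) (hj : j < n) :
    i * n + j - i * (i + 1) / 2 < n * (n + 1) / 2 := by
  obtain ⟨k, hk⟩ := Nat.even_mul_succ_self i
  obtain ⟨l, hl⟩ := Nat.even_mul_succ_self n
  have hiZ : (i : ℤ) < n := by exact_mod_cast hi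
  have hjZ : (j : ℤ) < n := by exact_mod_cast hj
  have hkZ : (i : ℤ) * (i + 1) = k + k := by exact_mod_cast hk
  have hlZ : (n : ℤ) * (n + 1) = l + l := by exact_mod_cast hl
  have key : (i : ℤ) * n + j < l + k := by nlinarith [sq_nonneg ((n : ℤ) - i - 1)]
  have keyN : i * n + j < l + k := by exact_mod_cast key
  have hl0 : 0 < l := by
    have h2 : 1 * 2 ≤ n * (n + 1) := Nat.mul_le_mul (by omega) (by omega)
    omega
  omega

lemma pos_of_lt_mul {a c r : ℕ} (h : r < a * c) : 0 < c := by
  rcases Nat.eq_zero_or_pos c with h0 | h1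
  · subst h0; simp at h
  · exact h1

lemma div_lt_of_lt_mul' {a c r : ℕ} (h : r < a * c) : r / c < a :=
  Nat.div_lt_of_lt_mul (by rwa [Nat.mul_comm] at h)

/-- `idx2 i j` is the (0-indexed) position `i * p + j`, i.e. the vectorization index of the
entry in column `i` and row `j` (for `vec` of an `p × n`... used generically). -/
def idx2 {n p : ℕ} (i : Fin n) (j : Fin p) : Fin (n * p) :=
  ⟨i.val * p + j.val, encLt i.isLt j.isLt⟩

/-- position of the pair `(i,j)` in the half-vectorization enumeration. -/
def tri (n : ℕ) (i j : Fin n) : Fin (n * (n + 1) / 2) :=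
  ⟨i.val * n + j.val - i.val * (i.val + 1) / 2, triLt i.isLt j.isLt⟩

/-- Column-stacking vectorization: `vecM M ⟨j*a+i⟩ = M i j`. -/
def vecM {a b : ℕ} (M : Matrix (Fin a) (Fin b) ℝ) : Fin (b * a) → ℝ :=
  fun k => M ⟨k.val % a, Nat.mod_lt _ (pos_of_lt_mul k.isLt)⟩ ⟨k.val / a, div_lt_of_lt_mul' k.isLt⟩

/-- Kronecker product with `Fin` index arithmetic. -/
def kron {a b c d : ℕ} (M : Matrix (Fin a) (Fin b) ℝ) (N : Matrix (Fin c) (Fin d) ℝ) :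
    Matrix (Fin (a * c)) (Fin (b * d)) ℝ :=
  fun r s =>
    M ⟨r.val / c, div_lt_of_lt_mul' r.isLt⟩ ⟨s.val / d, div_lt_of_lt_mul' s.isLt⟩ *
    N ⟨r.val % c, Nat.mod_lt _ (pos_of_lt_mul r.isLt)⟩ ⟨s.val % d, Nat.mod_lt _ (pos_of_lt_mul s.isLt)⟩

/-- Elimination matrix `P₁` (deleting redundant rows of the identity). -/
def Pmat (n : ℕ) : Matrix (Fin (n * (n + 1) / 2)) (Fin (n * n)) ℝ :=
  fun r c => if ∃ i j : Fin n, i ≤ j ∧ r = tri n i j ∧ c = idx2 i j then 1 else 0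

/-- index of the mirrored entry. -/
def symIdx (n : ℕ) (r : Fin (n * n)) : Fin (n * n) :=
  if r.val % n < r.val / n then
    ⟨(r.val % n) * n + r.val / n,
      encLt (Nat.mod_lt _ (pos_of_lt_mul r.isLt)) (div_lt_of_lt_mul' r.isLt)⟩
  else r

/-- Symmetrization matrix `T₁`. -/
def Tmat (n : ℕ) : Matrix (Fin (n * n)) (Fin (n * n)) ℝ :=
  fun r c => if c = symIdx n r then 1 else 0

/-- Duplication matrix `Q₁` (deleting columns of `T₁`). -/
def Qmat (n : ℕ) : Matrix (Fin (n * n)) (Fin (n * (n + 1) / 2)) ℝ :=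
  fun r c => if ∃ i j : Fin n, i ≤ j ∧ c = tri n i j ∧ symIdx n r = idx2 i j then 1 else 0

/-- spectral norm of a real matrix. -/
noncomputable def spec {a b : ℕ} (M : Matrix (Fin a) (Fin b) ℝ) : ℝ :=
  ‖LinearMap.toContinuousLinearMap (Matrix.toEuclideanLin M)‖

/-- Euclidean norm of a vector. -/
noncomputable def vnorm {k : ℕ} (v : Fin k → ℝ) : ℝ := Real.sqrt (∑ i, v i ^ 2)

/-- largest "eigenvalue" (supremum of the Rayleigh quotient over the unit sphere). -/
noncomputable def lamMax {k : ℕ} (M : Matrix (Fin k) (Fin k) ℝ) : ℝ :=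
  sSup {r : ℝ | ∃ v : Fin k → ℝ, (∑ i, v i ^ 2) = 1 ∧ v ⬝ᵥ M.mulVec v = r}

/-- smallest "eigenvalue" (infimum of the Rayleigh quotient over the unit sphere). -/
noncomputable def lamMin {k : ℕ} (M : Matrix (Fin k) (Fin k) ℝ) : ℝ :=
  sInf {r : ℝ | ∃ v : Fin k → ℝ, (∑ i, v i ^ 2) = 1 ∧ v ⬝ᵥ M.mulVec v = r}

/-- time-varying linear dynamical system recursion. -/
def ldsTV {d : ℕ} (M : ℕ → Matrix (Fin d) (Fin d) ℝ) (g : ℕ → Fin d → ℝ)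
    (x0 : Fin d → ℝ) : ℕ → Fin d → ℝ
  | 0 => x0
  | t + 1 => (M t).mulVec (ldsTV M g x0 t) + g t


/-- Controllability matrix `[M^{d−1}N ⋯ MN N]`. -/
noncomputable def ctrb {d e : ℕ} (M : Matrix (Fin d) (Fin d) ℝ) (N : Matrix (Fin d) (Fin e) ℝ) :
    Matrix (Fin d) (Fin (d * e)) ℝ :=
  fun r c => (M ^ (d - 1 - c.val / e) * N) r ⟨c.val % e, Nat.mod_lt _ (pos_of_lt_mul c.isLt)⟩

/-- extend a finitely indexed input-mean sequence by zero. -/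
def nuExt {m ℓ : ℕ} (ν : Fin ℓ → Fin m → ℝ) : ℕ → Fin m → ℝ :=
  fun t => if h : t < ℓ then ν ⟨t, h⟩ else 0

/-- first-moment sequence `μ_{t+1} = A μ_t + B ν_t`. -/
noncomputable def muSeqD {n m ℓ : ℕ} (A : Matrix (Fin n) (Fin n) ℝ)
    (B : Matrix (Fin n) (Fin m) ℝ) (μ0 : Fin n → ℝ) (ν : Fin ℓ → Fin m → ℝ) :
    ℕ → Fin n → ℝ :=
  ldsTV (fun _ => A) (fun s => B.mulVec (nuExt ν s)) μ0

/-- The data matrix `Z = [[μ_{ℓ−1} ⋯ μ₀]; [ν_{ℓ−1} ⋯ ν₀]]`. -/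
noncomputable def ZmatD {n m ℓ : ℕ} (A : Matrix (Fin n) (Fin n) ℝ)
    (B : Matrix (Fin n) (Fin m) ℝ) (μ0 : Fin n → ℝ) (ν : Fin ℓ → Fin m → ℝ) :
    Matrix (Fin (n + m)) (Fin ℓ) ℝ :=
  fun r c =>
    if h : r.val < n then muSeqD A B μ0 ν (ℓ - 1 - c.val) ⟨r.val, h⟩
    else nuExt ν (ℓ - 1 - c.val) ⟨r.val - n, by have := r.isLt; omega⟩

/-- symmetric matricization of a half-vectorized symmetric matrix. -/
def smat (m : ℕ) (v : Fin (m * (m + 1) / 2) → ℝ) : Matrix (Fin m) (Fin m) ℝ :=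
  fun i j => if i ≤ j then v (tri m i j) else v (tri m j i)

/-- extend the input-covariance parameters (given via `svec` coordinates) by zero. -/
def UbarExt {m ℓ : ℕ} (w : Fin ℓ → Fin (m * (m + 1) / 2) → ℝ) :
    ℕ → Matrix (Fin m) (Fin m) ℝ :=
  fun t => if h : t < ℓ then smat m (w ⟨t, h⟩) else 0

/-- `Ũ_t = P₂ vec(Ū_t + ν_t ν_tᵀ)`. -/
noncomputable def UtilD {m ℓ : ℕ} (ν : Fin ℓ → Fin m → ℝ)
    (w : Fin ℓ → Fin (m * (m + 1) / 2) → ℝ) (t : ℕ) : Fin (m * (m + 1) / 2) → ℝ :=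
  (Pmat m).mulVec (vecM (UbarExt w t + Matrix.of fun i j => nuExt ν t i * nuExt ν t j))

/-- The second-moment sequence
`X̃_{t+1} = (Ã + Σ̃_A') X̃_t + (B̃ + Σ̃_B') Ũ_t + K_{BA} W_t + K_{AB} W_t'`. -/
noncomputable def XtilSeqD {n m ℓ : ℕ} (A : Matrix (Fin n) (Fin n) ℝ)
    (B : Matrix (Fin n) (Fin m) ℝ) (SigAp : Matrix (Fin (n * n)) (Fin (n * n)) ℝ)
    (SigBp : Matrix (Fin (n * n)) (Fin (m * m)) ℝ) (μ0 : Fin n → ℝ)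
    (X0 : Fin (n * (n + 1) / 2) → ℝ) (ν : Fin ℓ → Fin m → ℝ)
    (w : Fin ℓ → Fin (m * (m + 1) / 2) → ℝ) : ℕ → Fin (n * (n + 1) / 2) → ℝ :=
  ldsTV (fun _ => Pmat n * kron A A * Qmat n + Pmat n * SigAp * Qmat n)
    (fun t =>
      (Pmat n * kron B B * Qmat m + Pmat n * SigBp * Qmat m).mulVec (UtilD ν w t) +
      (Pmat n * kron B A).mulVec
        (vecM (Matrix.of fun (i : Fin n) (j : Fin m) => muSeqD A B μ0 ν t i * nuExt ν t j)) +
      (Pmat n * kron A B).mulVec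
        (vecM (Matrix.of fun (i : Fin m) (j : Fin n) => nuExt ν t i * muSeqD A B μ0 ν t j)))
    X0

/-- The data matrix `D = [[X̃_{ℓ−1} ⋯ X̃₀]; [Ũ_{ℓ−1} ⋯ Ũ₀]]`. -/
noncomputable def DmatD {n m ℓ : ℕ} (A : Matrix (Fin n) (Fin n) ℝ)
    (B : Matrix (Fin n) (Fin m) ℝ) (SigAp : Matrix (Fin (n * n)) (Fin (n * n)) ℝ)
    (SigBp : Matrix (Fin (n * n)) (Fin (m * m)) ℝ) (μ0 : Fin n → ℝ)
    (X0 : Fin (n * (n + 1) / 2) → ℝ) (ν : Fin ℓ → Fin m → ℝ)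
    (w : Fin ℓ → Fin (m * (m + 1) / 2) → ℝ) :
    Matrix (Fin (n * (n + 1) / 2 + m * (m + 1) / 2)) (Fin ℓ) ℝ :=
  fun r c =>
    if h : r.val < n * (n + 1) / 2 then
      XtilSeqD A B SigAp SigBp μ0 X0 ν w (ℓ - 1 - c.val) ⟨r.val, h⟩
    else UtilD ν w (ℓ - 1 - c.val) ⟨r.val - n * (n + 1) / 2, by have := r.isLt; omega⟩

/-- A continuous function whose restriction to every affine line is a real polynomial. -/
def PolyOnLines {E : Type*} [AddCommGroup E] [Module ℝ E] [TopologicalSpace E]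
    (f : E → ℝ) : Prop :=
  Continuous f ∧ ∀ x v : E, ∃ p : Polynomial ℝ, ∀ t : ℝ, f (x + t • v) = p.eval t

namespace PolyOnLines

variable {E : Type*} [AddCommGroup E] [Module ℝ E] [TopologicalSpace E]

lemma const (c : ℝ) : PolyOnLines (fun _ : E => c) :=
  ⟨continuous_const, fun _ _ => ⟨Polynomial.C c, fun _ => by simp⟩⟩

lemma of_isLinearMap {f : E → ℝ} (hc : Continuous f) (hf : IsLinearMap ℝ f) : PolyOnLines f :=
  ⟨hc, fun x v => ⟨Polynomial.C (f x) + Polynomial.C (f v) * Polynomial.X,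
    fun t => by simp [hf.map_add, hf.map_smul, mul_comm t]⟩⟩

lemma add {f g : E → ℝ} (hf : PolyOnLines f) (hg : PolyOnLines g) :
    PolyOnLines (fun x => f x + g x) := by
  refine ⟨hf.1.add hg.1, fun x v => ?_⟩
  obtain ⟨p, hp⟩ := hf.2 x v
  obtain ⟨q, hq⟩ := hg.2 x v
  exact ⟨p + q, fun t => by simp [hp, hq]⟩

lemma mul {f g : E → ℝ} (hf : PolyOnLines f) (hg : PolyOnLines g) :
    PolyOnLines (fun x => f x * g x) := by
  refine ⟨hf.1.mul hg.1, fun x v => ?_⟩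
  obtain ⟨p, hp⟩ := hf.2 x v
  obtain ⟨q, hq⟩ := hg.2 x v
  exact ⟨p * q, fun t => by simp [hp, hq]⟩

lemma sum {ι : Type*} (s : Finset ι) {f : ι → E → ℝ} (hf : ∀ i, PolyOnLines (f i)) :
    PolyOnLines (fun x => ∑ i ∈ s, f i x) := by
  classical
  induction s using Finset.induction_on with
  | empty => simpa using const (E := E) 0
  | insert a s ha ih => simpa [Finset.sum_insert ha] using (hf a).add ih

lemma prod {ι : Type*} (s : Finset ι) {f : ι → E → ℝ} (hf : ∀ i, PolyOnLines (f i)) :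
    PolyOnLines (fun x => ∏ i ∈ s, f i x) := by
  classical
  induction s using Finset.induction_on with
  | empty => simpa using const (E := E) 1
  | insert a s ha ih => simpa [Finset.prod_insert ha] using (hf a).mul ih

lemma det {ι : Type*} [Fintype ι] [DecidableEq ι] {M : E → Matrix ι ι ℝ}
    (hM : ∀ i j, PolyOnLines (fun x => M x i j)) : PolyOnLines (fun x => (M x).det) := by
  simp only [Matrix.det_apply']
  exact sum _ fun σ => (const _).mul (prod _ fun i => hM _ _)

lemma mulVec {ι κ : Type*} [Fintype κ] (M : Matrix ι κ ℝ) {g : E → κ → ℝ}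
    (hg : ∀ j, PolyOnLines (fun x => g x j)) (i : ι) :
    PolyOnLines (fun x => M.mulVec (g x) i) := by
  simp only [Matrix.mulVec, dotProduct]
  exact sum _ fun j => (const _).mul (hg j)

lemma ldsTV {d : ℕ} (M : ℕ → Matrix (Fin d) (Fin d) ℝ) {g : E → ℕ → Fin d → ℝ}
    (x0 : Fin d → ℝ) (hg : ∀ t i, PolyOnLines (fun x => g x t i)) (t : ℕ) :
    ∀ i, PolyOnLines (fun x => ldsTV M (g x) x0 t i) := by
  induction t with
  | zero => exact fun i => const _
  | succ t ih => exact fun i => (mulVec (M t) ih i).add (hg t i)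

end PolyOnLines

/-- A function that is polynomial on lines and not identically zero is almost everywhere
nonzero. By Fubini, for almost every scaling factor `t`, almost every `v` satisfies
`f (x₀ + t • v) ≠ 0`. -/
lemma PolyOnLines.ae_ne_zero {E : Type*} [NormedAddCommGroup E] [NormedSpace ℝ E]
    [FiniteDimensional ℝ E] [MeasurableSpace E] [BorelSpace E] (μ : Measure E)
    [μ.IsAddHaarMeasure] {f : E → ℝ} (hf : PolyOnLines f) {x₀ : E} (h₀ : f x₀ ≠ 0) :
    ∀ᵐ y ∂μ, f y ≠ 0 := by
  have hline : ∀ v : E, ∀ᵐ t : ℝ, f (x₀ + t • v) ≠ 0 := by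
    intro v
    obtain ⟨p, hp⟩ := hf.2 x₀ v
    have hp0 : p ≠ 0 := by
      rintro rfl
      apply h₀
      simpa using hp 0
    refine (p.rootSet_finite ℝ).countable.ae_notMem volume |>.mono fun t ht h => ht ?_
    rw [Polynomial.mem_rootSet]
    exact ⟨hp0, by rw [Polynomial.coe_aeval_eq_eval, ← hp, h]⟩
  have hmeas : MeasurableSet {q : E × ℝ | f (x₀ + q.2 • q.1) ≠ 0} := by
    have hc : Continuous fun q : E × ℝ => f (x₀ + q.2 • q.1) := hf.1.comp (by fun_prop)
    exact (isOpen_ne.preimage hc).measurableSet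
  have hswap : ∀ᵐ t : ℝ, ∀ᵐ v ∂μ, f (x₀ + t • v) ≠ 0 :=
    (Measure.ae_ae_comm (μ := μ) (ν := (volume : Measure ℝ))
      (p := fun v t => f (x₀ + t • v) ≠ 0) hmeas).1 (ae_of_all _ hline)
  obtain ⟨t, ht, ht0⟩ := (hswap.and (Measure.ae_ne volume (0 : ℝ))).exists
  have hq : Measure.QuasiMeasurePreserving (fun y : E => t⁻¹ • (y - x₀)) μ μ := by
    refine Measure.QuasiMeasurePreserving.comp (g := fun y : E => t⁻¹ • y) ?_
      (measurePreserving_sub_right μ x₀).quasiMeasurePreserving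
    refine ⟨by fun_prop, ?_⟩
    rw [Measure.map_addHaar_smul μ (inv_ne_zero ht0)]
    exact Measure.smul_absolutelyContinuous
  filter_upwards [hq.ae ht] with y hy
  simpa [smul_smul, ht0] using hy

/-- A subspace that contains the range of `N` and is invariant under `M` is everything if the
pair `(M, N)` is controllable. -/
lemma eq_top_of_ctrb_rank {d e : ℕ} {M : Matrix (Fin d) (Fin d) ℝ}
    {N : Matrix (Fin d) (Fin e) ℝ} (h : (ctrb M N).rank = d) (S : Submodule ℝ (Fin d → ℝ))
    (hM : ∀ x ∈ S, M.mulVec x ∈ S) (hN : ∀ u, N.mulVec u ∈ S) : S = ⊤ := by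
  have hpow : ∀ (k : ℕ) (u : Fin e → ℝ), (M ^ k * N).mulVec u ∈ S := by
    intro k u
    induction k with
    | zero => simpa using hN u
    | succ k ih =>
      rw [pow_succ', Matrix.mul_assoc, ← Matrix.mulVec_mulVec]
      exact hM _ ih
  have hspan : Submodule.span ℝ (Set.range (ctrb M N).col) = ⊤ := by
    apply Submodule.eq_top_of_finrank_eq
    rw [← Matrix.rank_eq_finrank_span_cols, h]
    simp
  rw [eq_top_iff, ← hspan, Submodule.span_le]
  rintro _ ⟨c, rfl⟩
  have hc := hpow (d - 1 - c.val / e)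
    (Pi.single ⟨c.val % e, Nat.mod_lt _ (pos_of_lt_mul c.isLt)⟩ 1)
  rw [Matrix.mulVec_single_one] at hc
  exact hc

lemma ldsTV_congr {d : ℕ} (M : ℕ → Matrix (Fin d) (Fin d) ℝ) {g g' : ℕ → Fin d → ℝ}
    (x0 : Fin d → ℝ) {T : ℕ} (h : ∀ s < T, g s = g' s) :
    ∀ t ≤ T, ldsTV M g x0 t = ldsTV M g' x0 t := by
  intro t
  induction t with
  | zero => exact fun _ => rfl
  | succ t ih =>
    intro ht
    simp only [ldsTV, ih (by omega), h t (by omega)]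

/-- The span of the first `t` state-input pairs of `x_{s+1} = M x_s + N u_s`. -/
noncomputable def trajSpan {d e : ℕ} (M : Matrix (Fin d) (Fin d) ℝ)
    (N : Matrix (Fin d) (Fin e) ℝ) (x0 : Fin d → ℝ) (u : ℕ → Fin e → ℝ) (t : ℕ) :
    Submodule ℝ ((Fin d → ℝ) × (Fin e → ℝ)) :=
  Submodule.span ℝ
    ((fun s => (ldsTV (fun _ => M) (fun s => N.mulVec (u s)) x0 s, u s)) '' Set.Iio t)

/-- As long as the state-input pairs do not span, some next input increases the span. -/
lemma exists_input_notMem_trajSpan {d e : ℕ} {M : Matrix (Fin d) (Fin d) ℝ}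
    {N : Matrix (Fin d) (Fin e) ℝ} (h : (ctrb M N).rank = d) (x0 : Fin d → ℝ)
    (u : ℕ → Fin e → ℝ) (t : ℕ) (hV : trajSpan M N x0 u t ≠ ⊤) :
    ∃ v : Fin e → ℝ,
      (ldsTV (fun _ => M) (fun s => N.mulVec (u s)) x0 t, v) ∉ trajSpan M N x0 u t := by
  by_contra! hall
  apply hV
  set x := ldsTV (fun _ => M) (fun s => N.mulVec (u s)) x0 with hx
  set V := trajSpan M N x0 u t with hVdef
  have hsnd : ∀ v, ((0 : Fin d → ℝ), v) ∈ V := by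
    intro v
    simpa using V.sub_mem (hall v) (hall 0)
  let S : Submodule ℝ (Fin d → ℝ) := V.comap (LinearMap.inl ℝ (Fin d → ℝ) (Fin e → ℝ))
  have hS : ∀ y v, (y, v) ∈ V ↔ y ∈ S := by
    intro y v
    change _ ↔ (y, (0 : Fin e → ℝ)) ∈ V
    constructor
    · intro hy
      simpa using V.sub_mem hy (hsnd v)
    · intro hy
      simpa using V.add_mem hy (hsnd v)
  have hxS : ∀ s ≤ t, x s ∈ S := by
    intro s hs
    rcases hs.lt_or_eq with hs | rfl
    · exact (hS _ (u s)).1 (Submodule.subset_span ⟨s, hs, rfl⟩)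
    · exact (hS _ 0).1 (hall 0)
  have hmap : ∀ q ∈ V, M.mulVec q.1 + N.mulVec q.2 ∈ S := by
    intro q hq
    induction hq using Submodule.span_induction with
    | mem q hq =>
      obtain ⟨s, hs, rfl⟩ := hq
      exact hxS (s + 1) hs
    | zero => simp
    | add p q _ _ hp hq =>
      have := S.add_mem hp hq
      simp only [Prod.fst_add, Prod.snd_add, Matrix.mulVec_add]
      convert this using 1
      abel
    | smul c q _ hq =>
      have := S.smul_mem c hq
      simpa only [Prod.smul_fst, Prod.smul_snd, Matrix.mulVec_smul, smul_add] using this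
  have htop : S = ⊤ := by
    refine eq_top_of_ctrb_rank h S (fun y hy => ?_) fun v => ?_
    · simpa using hmap _ ((hS y 0).2 hy)
    · simpa using hmap _ (hsnd v)
  rw [eq_top_iff]
  rintro ⟨y, v⟩ -
  rw [hS, htop]
  trivial

/-- A controllable pair admits an input for which the first `t` state-input pairs are as
independent as possible. -/
lemma exists_input_finrank_trajSpan {d e : ℕ} {M : Matrix (Fin d) (Fin d) ℝ}
    {N : Matrix (Fin d) (Fin e) ℝ} (h : (ctrb M N).rank = d) (x0 : Fin d → ℝ) (t : ℕ) :
    ∃ u : ℕ → Fin e → ℝ, min t (d + e) ≤ Module.finrank ℝ (trajSpan M N x0 u t) := by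
  induction t with
  | zero => exact ⟨0, by simp⟩
  | succ t ih =>
    obtain ⟨u, hu⟩ := ih
    by_cases hV : trajSpan M N x0 u t = ⊤
    · refine ⟨u, ?_⟩
      have hle : trajSpan M N x0 u t ≤ trajSpan M N x0 u (t + 1) :=
        Submodule.span_mono (Set.image_mono (Set.Iio_subset_Iio (Nat.le_succ t)))
      rw [hV, top_le_iff] at hle
      rw [hle]
      simp
    · obtain ⟨v, hv⟩ := exists_input_notMem_trajSpan h x0 u t hV
      refine ⟨Function.update u t v, ?_⟩
      have hx : ∀ s ≤ t, ldsTV (fun _ => M) (fun s => N.mulVec (Function.update u t v s)) x0 s =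
          ldsTV (fun _ => M) (fun s => N.mulVec (u s)) x0 s := by
        refine ldsTV_congr _ _ fun s hs => ?_
        rw [Function.update_of_ne hs.ne]
      have hlt : trajSpan M N x0 u t < trajSpan M N x0 (Function.update u t v) (t + 1) := by
        refine lt_of_le_of_ne ?_ fun heq => hv ?_
        · refine Submodule.span_mono ?_
          rintro _ ⟨s, hs, rfl⟩
          have hs' : s < t := hs
          refine ⟨s, Nat.lt_succ_of_lt hs', ?_⟩
          simp only [hx s hs'.le, Function.update_of_ne hs'.ne]
        · rw [heq]
          refine Submodule.subset_span ⟨t, Nat.lt_succ_self t, ?_⟩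
          simp only [hx t le_rfl, Function.update_self]
      have := Submodule.finrank_lt_finrank_of_lt hlt
      omega

lemma exists_input_trajSpan_eq_top {d e : ℕ} {M : Matrix (Fin d) (Fin d) ℝ}
    {N : Matrix (Fin d) (Fin e) ℝ} (h : (ctrb M N).rank = d) (x0 : Fin d → ℝ) {t : ℕ}
    (ht : d + e ≤ t) : ∃ u : ℕ → Fin e → ℝ, trajSpan M N x0 u t = ⊤ := by
  obtain ⟨u, hu⟩ := exists_input_finrank_trajSpan h x0 t
  refine ⟨u, Submodule.eq_top_of_finrank_eq (le_antisymm (Submodule.finrank_le _) ?_)⟩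
  simpa [min_eq_right ht] using hu

lemma tri_val_add {n : ℕ} {i j : Fin n} (hij : i ≤ j) :
    2 * (tri n i j).val + i.val * (i.val + 1) = 2 * (i.val * n + j.val) := by
  obtain ⟨k, hk⟩ := Nat.even_mul_succ_self i.val
  have hi := i.isLt
  have hle : i.val * (i.val + 1) ≤ i.val * n := Nat.mul_le_mul_left _ hi
  simp only [tri]
  omega

lemma tri_lt_tri {n : ℕ} {i j i' j' : Fin n} (hij : i ≤ j) (hij' : i' ≤ j') (h : i < i') :
    (tri n i j).val < (tri n i' j').val := by
  have h1 := tri_val_add hij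
  have h2 := tri_val_add hij'
  have hj := j.isLt
  have hi' := i'.isLt
  have hij'' : i'.val ≤ j'.val := hij'
  have hlt : i.val < i'.val := h
  obtain ⟨k, hk⟩ := Nat.exists_eq_add_of_lt hlt
  obtain ⟨l, hl⟩ := Nat.exists_eq_add_of_lt hi'
  rw [hk] at h2 hij'' hl
  have e1 := congrArg (fun x => i.val * x) hl
  have e2 := congrArg (fun x => k * x) hl
  nlinarith [Nat.zero_le (k * l), Nat.zero_le (k * k)]

lemma tri_injective {n : ℕ} {i j i' j' : Fin n} (hij : i ≤ j) (hij' : i' ≤ j')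
    (h : tri n i j = tri n i' j') : i = i' ∧ j = j' := by
  have hi : i = i' := by
    rcases lt_trichotomy i i' with hlt | heq | hlt
    · exact absurd (congrArg Fin.val h) (tri_lt_tri hij hij' hlt).ne
    · exact heq
    · exact absurd (congrArg Fin.val h) (tri_lt_tri hij' hij hlt).ne'
  subst hi
  refine ⟨rfl, Fin.ext ?_⟩
  have h1 := tri_val_add hij
  have h2 := tri_val_add hij'
  rw [h] at h1
  omega

lemma exists_tri_eq {n : ℕ} (r : Fin (n * (n + 1) / 2)) : ∃ i j : Fin n, i ≤ j ∧ tri n i j = r := by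
  have key : ∀ k ≤ n, 2 * r.val + k * k < 2 * (k * n) + k →
      ∃ i j : Fin n, i ≤ j ∧ tri n i j = r := by
    intro k
    induction k with
    | zero => intro _ h; simp at h
    | succ k ih =>
      intro hk h
      by_cases hlt : 2 * r.val + k * k < 2 * (k * n) + k
      · exact ih (by omega) hlt
      · obtain ⟨l, hl⟩ := Nat.even_mul_succ_self k
        have e1 : k * (k + 1) = k * k + k := by ring
        have e2 : (k + 1) * (k + 1) = k * k + 2 * k + 1 := by ring
        have e3 : (k + 1) * n = k * n + n := by ring
        rw [e2, e3] at h
        have hij : (⟨k, hk⟩ : Fin n) ≤ ⟨r.val + l - k * n, by omega⟩ := by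
          rw [Fin.mk_le_mk]
          omega
        refine ⟨_, _, hij, Fin.ext ?_⟩
        have := tri_val_add hij
        simp only at this
        omega
  refine key n le_rfl ?_
  have hr := r.isLt
  obtain ⟨l, hl⟩ := Nat.even_mul_succ_self n
  have e1 : n * (n + 1) = n * n + n := by ring
  omega

lemma vecM_idx2 {a b : ℕ} (M : Matrix (Fin a) (Fin b) ℝ) (i : Fin b) (j : Fin a) :
    vecM M (idx2 i j) = M j i := by
  have hj := j.isLt
  have ha : 0 < a := by omega
  have hmod : (idx2 i j).val % a = j := by
    change (i.val * a + j.val) % a = j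
    rw [mul_comm, Nat.mul_add_mod, Nat.mod_eq_of_lt hj]
  have hdiv : (idx2 i j).val / a = i := by
    change (i.val * a + j.val) / a = i
    rw [mul_comm, Nat.mul_add_div ha, Nat.div_eq_of_lt hj, add_zero]
  exact congrArg₂ M (Fin.ext hmod) (Fin.ext hdiv)

/-- `P₂ vec` inverts the symmetric matricization of a half-vectorized matrix. -/
lemma Pmat_mulVec_vecM_smat (m : ℕ) (v : Fin (m * (m + 1) / 2) → ℝ) :
    (Pmat m).mulVec (vecM (smat m v)) = v := by
  ext r
  obtain ⟨i, j, hij, rfl⟩ := exists_tri_eq r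
  have hrow : ∀ c, Pmat m (tri m i j) c = if c = idx2 i j then 1 else 0 := by
    intro c
    simp only [Pmat]
    congr 1
    refine propext ⟨?_, fun hc => ⟨i, j, hij, rfl, hc⟩⟩
    rintro ⟨i', j', hij', ht, rfl⟩
    obtain ⟨rfl, rfl⟩ := tri_injective hij hij' ht
    rfl
  simp only [Matrix.mulVec, dotProduct, hrow, ite_mul, one_mul, zero_mul, Finset.sum_ite_eq',
    Finset.mem_univ, if_true, vecM_idx2, smat]
  split_ifs with hji
  · rw [le_antisymm hij hji]
  · rfl

lemma nuExt_zero {m ℓ : ℕ} (t : ℕ) : nuExt (0 : Fin ℓ → Fin m → ℝ) t = 0 := by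
  simp [nuExt]

lemma vecM_zero {a b : ℕ} : vecM (0 : Matrix (Fin a) (Fin b) ℝ) = 0 := rfl

lemma UtilD_zero {m ℓ : ℕ} (u : ℕ → Fin (m * (m + 1) / 2) → ℝ) {t : ℕ} (ht : t < ℓ) :
    UtilD (0 : Fin ℓ → Fin m → ℝ) (fun s => u s) t = u t := by
  have h0 : (Matrix.of fun i j : Fin m => nuExt (0 : Fin ℓ → Fin m → ℝ) t i *
      nuExt (0 : Fin ℓ → Fin m → ℝ) t j) = 0 := by
    ext i j
    simp [nuExt_zero]
  rw [UtilD, h0, add_zero, UbarExt, dif_pos ht, Pmat_mulVec_vecM_smat]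

lemma XtilSeqD_zero {n m ℓ : ℕ} (A : Matrix (Fin n) (Fin n) ℝ)
    (B : Matrix (Fin n) (Fin m) ℝ) (SigAp : Matrix (Fin (n * n)) (Fin (n * n)) ℝ)
    (SigBp : Matrix (Fin (n * n)) (Fin (m * m)) ℝ) (μ0 : Fin n → ℝ)
    (X0 : Fin (n * (n + 1) / 2) → ℝ) (u : ℕ → Fin (m * (m + 1) / 2) → ℝ) {t : ℕ} (ht : t ≤ ℓ) :
    XtilSeqD A B SigAp SigBp μ0 X0 (0 : Fin ℓ → Fin m → ℝ) (fun s => u s) t =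
      ldsTV (fun _ => Pmat n * kron A A * Qmat n + Pmat n * SigAp * Qmat n)
        (fun s => (Pmat n * kron B B * Qmat m + Pmat n * SigBp * Qmat m).mulVec (u s)) X0 t := by
  refine ldsTV_congr _ _ (fun s hs => ?_) t ht
  have h1 : (Matrix.of fun (i : Fin n) (j : Fin m) =>
      muSeqD A B μ0 (0 : Fin ℓ → Fin m → ℝ) s i * nuExt (0 : Fin ℓ → Fin m → ℝ) s j) = 0 := by
    ext i j
    simp [nuExt_zero]
  have h2 : (Matrix.of fun (i : Fin m) (j : Fin n) =>
      nuExt (0 : Fin ℓ → Fin m → ℝ) s i * muSeqD A B μ0 (0 : Fin ℓ → Fin m → ℝ) s j) = 0 := by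
    ext i j
    simp [nuExt_zero]
  simp only [h1, h2, vecM_zero, Matrix.mulVec_zero, add_zero, UtilD_zero u hs]

/-- For zero input means and suitable input covariances the Gram matrix of `D` is nonsingular. -/
lemma exists_det_DmatD_ne_zero {n m ℓ : ℕ}
    (A : Matrix (Fin n) (Fin n) ℝ) (B : Matrix (Fin n) (Fin m) ℝ)
    (SigAp : Matrix (Fin (n * n)) (Fin (n * n)) ℝ)
    (SigBp : Matrix (Fin (n * n)) (Fin (m * m)) ℝ)
    (hl : n * (n + 1) / 2 + m * (m + 1) / 2 ≤ ℓ)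
    (hctrb : (ctrb (Pmat n * kron A A * Qmat n + Pmat n * SigAp * Qmat n)
        (Pmat n * kron B B * Qmat m + Pmat n * SigBp * Qmat m)).rank = n * (n + 1) / 2)
    (μ0 : Fin n → ℝ) (X0 : Fin (n * (n + 1) / 2) → ℝ) :
    ∃ w : Fin ℓ → Fin (m * (m + 1) / 2) → ℝ,
      (DmatD A B SigAp SigBp μ0 X0 0 w * (DmatD A B SigAp SigBp μ0 X0 0 w)ᵀ).det ≠ 0 := by
  obtain ⟨u, hu⟩ := exists_input_trajSpan_eq_top hctrb X0 hl
  refine ⟨fun s => u s, fun hdet => ?_⟩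
  obtain ⟨y, hy0, hy⟩ := Matrix.exists_mulVec_eq_zero_iff.2 hdet
  apply hy0
  set D := DmatD A B SigAp SigBp μ0 X0 (0 : Fin ℓ → Fin m → ℝ) (fun s => u s) with hD
  have hker : Dᵀ.mulVec y = 0 := by
    rw [← Matrix.mulVec_mulVec] at hy
    rw [← dotProduct_self_eq_zero, Matrix.dotProduct_mulVec, Matrix.vecMul_transpose, hy,
      zero_dotProduct]
  let φ : ((Fin (n * (n + 1) / 2) → ℝ) × (Fin (m * (m + 1) / 2) → ℝ)) →ₗ[ℝ] ℝ :=
    LinearMap.coprod (dotProductBilin ℝ ℝ fun i => y (Fin.castAdd _ i))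
      (dotProductBilin ℝ ℝ fun i => y (Fin.natAdd _ i))
  have hφ : ∀ p q, φ (p, q) = ∑ i, y (Fin.castAdd _ i) * p i + ∑ i, y (Fin.natAdd _ i) * q i :=
    fun p q => rfl
  have hφ0 : φ = 0 := by
    refine LinearMap.ext_on hu ?_
    rintro _ ⟨s, hs, rfl⟩
    have hs' : s < ℓ := hs
    have hcol := congrFun hker ⟨ℓ - 1 - s, by omega⟩
    have hidx : ℓ - 1 - (ℓ - 1 - s) = s := by omega
    simp only [Matrix.mulVec, dotProduct, Matrix.transpose_apply, Fin.sum_univ_add] at hcol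
    simp only [hφ, LinearMap.zero_apply]
    rw [Pi.zero_apply] at hcol
    rw [← hcol]
    congr 1 <;> refine Finset.sum_congr rfl fun i _ => ?_ <;> rw [mul_comm]
    · simp [hD, DmatD, hidx, XtilSeqD_zero A B SigAp SigBp μ0 X0 u hs'.le]
    · simp [hD, DmatD, hidx, UtilD_zero u hs']
  ext r
  refine Fin.addCases (fun i => ?_) (fun i => ?_) r
  · have := hφ (Pi.single i 1) 0
    simpa [hφ0, Pi.single_apply] using this.symm
  · have := hφ 0 (Pi.single i 1)
    simpa [hφ0, Pi.single_apply] using this.symm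

/-- Input means together with half-vectorized input covariances. -/
abbrev InputParams (m ℓ : ℕ) : Type :=
  (Fin ℓ → Fin m → ℝ) × (Fin ℓ → Fin (m * (m + 1) / 2) → ℝ)

section Entries

variable {n m ℓ : ℕ}

lemma polyOnLines_nuExt (t : ℕ) (i : Fin m) :
    PolyOnLines (fun ρ : InputParams m ℓ => nuExt ρ.1 t i) := by
  by_cases ht : t < ℓ
  · simp only [nuExt, dif_pos ht]
    exact PolyOnLines.of_isLinearMap (by fun_prop) ⟨fun _ _ => rfl, fun _ _ => rfl⟩
  · simp only [nuExt, dif_neg ht]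
    exact PolyOnLines.const _

lemma polyOnLines_UbarExt (t : ℕ) (i j : Fin m) :
    PolyOnLines (fun ρ : InputParams m ℓ => UbarExt ρ.2 t i j) := by
  by_cases ht : t < ℓ
  · have hcoord : ∀ k, PolyOnLines (fun ρ : InputParams m ℓ => ρ.2 ⟨t, ht⟩ k) := fun k =>
      PolyOnLines.of_isLinearMap (by fun_prop) ⟨fun _ _ => rfl, fun _ _ => rfl⟩
    simp only [UbarExt, dif_pos ht, smat]
    split_ifs
    · exact hcoord _
    · exact hcoord _
  · simp only [UbarExt, dif_neg ht]
    exact PolyOnLines.const _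

lemma polyOnLines_UtilD (t : ℕ) (i : Fin (m * (m + 1) / 2)) :
    PolyOnLines (fun ρ : InputParams m ℓ => UtilD ρ.1 ρ.2 t i) :=
  PolyOnLines.mulVec _ (fun _ => (polyOnLines_UbarExt t _ _).add
    ((polyOnLines_nuExt t _).mul (polyOnLines_nuExt t _))) i

lemma polyOnLines_muSeqD (A : Matrix (Fin n) (Fin n) ℝ) (B : Matrix (Fin n) (Fin m) ℝ)
    (μ0 : Fin n → ℝ) (t : ℕ) (i : Fin n) :
    PolyOnLines (fun ρ : InputParams m ℓ => muSeqD A B μ0 ρ.1 t i) :=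
  PolyOnLines.ldsTV _ μ0 (fun s => PolyOnLines.mulVec B (polyOnLines_nuExt s)) t i

lemma polyOnLines_XtilSeqD (A : Matrix (Fin n) (Fin n) ℝ) (B : Matrix (Fin n) (Fin m) ℝ)
    (SigAp : Matrix (Fin (n * n)) (Fin (n * n)) ℝ)
    (SigBp : Matrix (Fin (n * n)) (Fin (m * m)) ℝ) (μ0 : Fin n → ℝ)
    (X0 : Fin (n * (n + 1) / 2) → ℝ) (t : ℕ) (i : Fin (n * (n + 1) / 2)) :
    PolyOnLines (fun ρ : InputParams m ℓ => XtilSeqD A B SigAp SigBp μ0 X0 ρ.1 ρ.2 t i) :=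
  PolyOnLines.ldsTV _ X0 (fun s k =>
    ((PolyOnLines.mulVec _ (polyOnLines_UtilD s) k).add
      (PolyOnLines.mulVec _
        (fun _ => (polyOnLines_muSeqD A B μ0 s _).mul (polyOnLines_nuExt s _)) k)).add
      (PolyOnLines.mulVec _
        (fun _ => (polyOnLines_nuExt s _).mul (polyOnLines_muSeqD A B μ0 s _)) k)) t i

lemma polyOnLines_DmatD (A : Matrix (Fin n) (Fin n) ℝ) (B : Matrix (Fin n) (Fin m) ℝ)
    (SigAp : Matrix (Fin (n * n)) (Fin (n * n)) ℝ)
    (SigBp : Matrix (Fin (n * n)) (Fin (m * m)) ℝ) (μ0 : Fin n → ℝ)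
    (X0 : Fin (n * (n + 1) / 2) → ℝ) (r : Fin (n * (n + 1) / 2 + m * (m + 1) / 2)) (c : Fin ℓ) :
    PolyOnLines (fun ρ : InputParams m ℓ => DmatD A B SigAp SigBp μ0 X0 ρ.1 ρ.2 r c) := by
  by_cases hr : r.val < n * (n + 1) / 2
  · simp only [DmatD, dif_pos hr]
    exact polyOnLines_XtilSeqD A B SigAp SigBp μ0 X0 _ _
  · simp only [DmatD, dif_neg hr]
    exact polyOnLines_UtilD _ _

end Entries

/-- Proposition 5 of the paper: if `ℓ ≥ [n(n+1)+m(m+1)]/2` and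
`(Ã + Σ̃_A', B̃ + Σ̃_B')` is controllable, then for Lebesgue-almost all input means and
input covariances, the data matrix `D` has full row rank and `D Dᵀ` is invertible. -/
theorem statement4 {n m ℓ : ℕ} (hmn : m ≤ n)
    (A : Matrix (Fin n) (Fin n) ℝ) (B : Matrix (Fin n) (Fin m) ℝ)
    (SigAp : Matrix (Fin (n * n)) (Fin (n * n)) ℝ)
    (SigBp : Matrix (Fin (n * n)) (Fin (m * m)) ℝ)
    (hl : (n * (n + 1) + m * (m + 1)) / 2 ≤ ℓ)
    (hctrb : (ctrb (Pmat n * kron A A * Qmat n + Pmat n * SigAp * Qmat n)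
        (Pmat n * kron B B * Qmat m + Pmat n * SigBp * Qmat m)).rank = n * (n + 1) / 2)
    (μ0 : Fin n → ℝ) (X0 : Fin (n * (n + 1) / 2) → ℝ) :
    ∀ᵐ ρ ∂(volume :
        Measure ((Fin ℓ → Fin m → ℝ) × (Fin ℓ → Fin (m * (m + 1) / 2) → ℝ))),
      (DmatD A B SigAp SigBp μ0 X0 ρ.1 ρ.2).rank = n * (n + 1) / 2 + m * (m + 1) / 2 ∧
      IsUnit (DmatD A B SigAp SigBp μ0 X0 ρ.1 ρ.2 *
        (DmatD A B SigAp SigBp μ0 X0 ρ.1 ρ.2)ᵀ) := by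
  have hl' : n * (n + 1) / 2 + m * (m + 1) / 2 ≤ ℓ := by
    obtain ⟨a, ha⟩ := Nat.even_mul_succ_self n
    omega
  obtain ⟨w, hw⟩ := exists_det_DmatD_ne_zero A B SigAp SigBp hl' hctrb μ0 X0
  have hpoly : PolyOnLines (fun ρ : InputParams m ℓ =>
      (DmatD A B SigAp SigBp μ0 X0 ρ.1 ρ.2 * (DmatD A B SigAp SigBp μ0 X0 ρ.1 ρ.2)ᵀ).det) := by
    refine PolyOnLines.det fun i j => ?_
    simp only [Matrix.mul_apply, Matrix.transpose_apply]
    exact PolyOnLines.sum _ fun c => (polyOnLines_DmatD A B SigAp SigBp μ0 X0 i c).mul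
      (polyOnLines_DmatD A B SigAp SigBp μ0 X0 j c)
  have hpi : ∀ k, (volume : Measure (Fin ℓ → Fin k → ℝ)).IsAddHaarMeasure := fun k =>
    Measure.pi.isAddHaarMeasure fun _ : Fin ℓ => (volume : Measure (Fin k → ℝ))
  have hprod : (volume : Measure (InputParams m ℓ)).IsAddHaarMeasure :=
    Measure.prod.instIsAddHaarMeasure _ _
  filter_upwards [hpoly.ae_ne_zero volume (x₀ := (0, w)) hw] with ρ hρ
  have hunit := (Matrix.isUnit_iff_isUnit_det _).2 (isUnit_iff_ne_zero.2 hρ)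
  refine ⟨?_, hunit⟩
  rw [← Matrix.rank_self_mul_transpose, Matrix.rank_of_isUnit _ hunit, Fintype.card_fin]

end MultNoise
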